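/- Let μ⁰ and μ¹ be probability measures on ℝ^d with everywhere positive densities f⁰ and f¹ with respect to Lebesgue measure, representing the class-conditional distributions of X given Y = 0 and Y = 1 under equal class priors, and let P_X = (μ⁰ + μ¹)/2 be the marginal distribution of X. Let g(x) = log(f⁰(x)/f¹(x)), let δ*(x) = 1 iff g(x) ≤ 0 be the Bayes classifier, and let ĝ be a measurable function with plug-in classifier δ̂(x) = 1 iff ĝ(x) ≤ 0, where R(δ) = (1/2) μ⁰({δ = 1}) + (1/2) μ¹({δ = 0}). Suppose the margin assumption holds: there exist C₀ > 0 and α ≥ 0 such that P_X(0 < |g(X)| ≤ t) ≤ C₀ t^α for all t > 0. If Δ > 0 and |ĝ(x) − g(x)| ≤ Δ for all x ∈ ℝ^d, then R(δ̂) − R(δ*) ≤ (1/2) C₀ Δ^{α+1}. -/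

import Mathlib

open Real MeasureTheory
open scoped ENNReal

/-- The elementary bound `2 (a - b) / (a + b) ≤ log (a / b)` for `b ≤ a`,
cleared of denominators. -/
theorem two_mul_sub_le_add_mul_log_div {a b : ℝ} (hb : 0 < b) (hab : b ≤ a) :
    2 * (a - b) ≤ (a + b) * Real.log (a / b) := by
  have hx : 0 ≤ a / b - 1 := by
    rw [sub_nonneg, one_le_div hb]
    exact hab
  have h := Real.le_log_one_add_of_nonneg hx
  have ha : 0 < a + b := by linarith
  have e : 2 * (a / b - 1) / (a / b - 1 + 2) = 2 * (a - b) / (a + b) := by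
    have h1 : a / b - 1 + 2 = (a + b) / b := by
      field_simp
      ring
    rw [h1]
    field_simp
  rw [e, add_sub_cancel, div_le_iff₀ ha] at h
  linarith

/-- A gap between two positive reals is controlled by their log ratio. -/
theorem sub_le_of_log_div_le {a b D : ℝ} (hb : 0 < b) (hab : b ≤ a)
    (hD : Real.log (a / b) ≤ D) : a - b ≤ D / 2 * (a + b) := by
  have h := two_mul_sub_le_add_mul_log_div hb hab
  have h2 : (a + b) * Real.log (a / b) ≤ (a + b) * D :=
    mul_le_mul_of_nonneg_left hD (by linarith)
  linarith

/-- A nonnegative measurable density of a finite measure is integrable. -/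
theorem integrable_of_isFiniteMeasure_withDensity_ofReal {Ω : Type*} [MeasurableSpace Ω]
    {ν : Measure Ω} {f : Ω → ℝ} (hf : Measurable f) (hf0 : ∀ x, 0 ≤ f x)
    (h : IsFiniteMeasure (ν.withDensity fun x => ENNReal.ofReal (f x))) : Integrable f ν := by
  refine ⟨hf.aestronglyMeasurable, ?_⟩
  rw [hasFiniteIntegral_iff_ofReal (Filter.Eventually.of_forall hf0)]
  have := h.measure_univ_lt_top
  rwa [withDensity_apply _ MeasurableSet.univ, Measure.restrict_univ] at this

/-- The mass of a set under a real density is the integral of the density cut off to the set. -/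
theorem toReal_withDensity_ofReal_apply {Ω : Type*} [MeasurableSpace Ω]
    {ν : Measure Ω} {f : Ω → ℝ} (hf : Measurable f) (hf0 : ∀ x, 0 ≤ f x)
    {s : Set Ω} (hs : MeasurableSet s) :
    (ν.withDensity (fun x => ENNReal.ofReal (f x)) s).toReal = ∫ x, s.indicator f x ∂ν := by
  rw [withDensity_apply _ hs, integral_indicator hs,
    integral_eq_lintegral_of_nonneg_ae (Filter.Eventually.of_forall hf0)
      hf.aestronglyMeasurable]

/-- **Excess risk under the margin assumption.**
If the margin assumption holds with constants `C₀ > 0`, `α ≥ 0`, and the estimator `ĝ`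
of the log density ratio `g` satisfies `|ĝ - g| ≤ Δ` everywhere, then the excess risk of
the plug-in rule is at most `(1/2) C₀ Δ^{α+1}`. -/
theorem excess_risk_margin_bound
    (d : ℕ) (hd : 1 ≤ d)
    (f0 f1 : (Fin d → ℝ) → ℝ)
    (hf0meas : Measurable f0) (hf1meas : Measurable f1)
    (hf0pos : ∀ x, 0 < f0 x) (hf1pos : ∀ x, 0 < f1 x)
    (μ0 μ1 : Measure (Fin d → ℝ))
    (hμ0 : μ0 = MeasureTheory.volume.withDensity (fun x => ENNReal.ofReal (f0 x)))
    (hμ1 : μ1 = MeasureTheory.volume.withDensity (fun x => ENNReal.ofReal (f1 x)))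
    (hp0 : IsProbabilityMeasure μ0) (hp1 : IsProbabilityMeasure μ1)
    (PX : Measure (Fin d → ℝ))
    (hPX : PX = (1 / 2 : ℝ≥0∞) • (μ0 + μ1))
    (g ghat : (Fin d → ℝ) → ℝ)
    (hg : ∀ x, g x = Real.log (f0 x / f1 x))
    (hghat : Measurable ghat)
    (R : ((Fin d → ℝ) → Prop) → ℝ)
    (hR : ∀ δ : (Fin d → ℝ) → Prop,
      R δ = (1 / 2) * (μ0 {x | δ x}).toReal + (1 / 2) * (μ1 {x | ¬ δ x}).toReal)
    (C0 αm : ℝ) (hC0 : 0 < C0) (hαm : 0 ≤ αm)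
    (hmargin : ∀ t : ℝ, 0 < t →
      (PX {x | 0 < |g x| ∧ |g x| ≤ t}).toReal ≤ C0 * t ^ αm)
    (Δ : ℝ) (hΔ : 0 < Δ)
    (hbound : ∀ x, |ghat x - g x| ≤ Δ) :
    R (fun x => ghat x ≤ 0) - R (fun x => g x ≤ 0) ≤
      (1 / 2) * C0 * Δ ^ (αm + 1) := by
  have hgm : Measurable g := by
    rw [funext hg]
    exact Real.measurable_log.comp (hf0meas.div hf1meas)
  set A : Set (Fin d → ℝ) := {x | ghat x ≤ 0}
  set B : Set (Fin d → ℝ) := {x | g x ≤ 0}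
  set M : Set (Fin d → ℝ) := {x | 0 < |g x| ∧ |g x| ≤ Δ}
  have mA : MeasurableSet A := measurableSet_le hghat measurable_const
  have mB : MeasurableSet B := measurableSet_le hgm measurable_const
  have mM : MeasurableSet M :=
    (measurableSet_lt measurable_const hgm.abs).inter (measurableSet_le hgm.abs measurable_const)
  have i0 : Integrable f0 volume :=
    integrable_of_isFiniteMeasure_withDensity_ofReal hf0meas (fun x => (hf0pos x).le)
      (hμ0 ▸ inferInstance)
  have i1 : Integrable f1 volume :=
    integrable_of_isFiniteMeasure_withDensity_ofReal hf1meas (fun x => (hf1pos x).le)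
      (hμ1 ▸ inferInstance)
  have e0 : ∀ s, MeasurableSet s → (μ0 s).toReal = ∫ x, s.indicator f0 x := fun s hs => by
    rw [hμ0]
    exact toReal_withDensity_ofReal_apply hf0meas (fun x => (hf0pos x).le) hs
  have e1 : ∀ s, MeasurableSet s → (μ1 s).toReal = ∫ x, s.indicator f1 x := fun s hs => by
    rw [hμ1]
    exact toReal_withDensity_ofReal_apply hf1meas (fun x => (hf1pos x).le) hs
  have hPXM : (PX M).toReal = 1 / 2 * ((μ0 M).toReal + (μ1 M).toReal) := by
    rw [hPX, Measure.smul_apply, Measure.add_apply, smul_eq_mul, ENNReal.toReal_mul,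
      ENNReal.toReal_add (measure_ne_top _ _) (measure_ne_top _ _)]
    norm_num
  have pointwise : ∀ x, A.indicator f0 x + Aᶜ.indicator f1 x ≤
      (B.indicator f0 x + Bᶜ.indicator f1 x) +
        Δ / 2 * (M.indicator f0 x + M.indicator f1 x) := by
    intro x
    have p0 := hf0pos x
    have p1 := hf1pos x
    have hr : 0 < f0 x / f1 x := div_pos p0 p1
    have hb := abs_le.mp (hbound x)
    have hMnn : 0 ≤ Δ / 2 * (M.indicator f0 x + M.indicator f1 x) :=
      mul_nonneg (by linarith) (add_nonneg (Set.indicator_nonneg (fun y _ => (hf0pos y).le) x)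
        (Set.indicator_nonneg (fun y _ => (hf1pos y).le) x))
    by_cases hxA : x ∈ A <;> by_cases hxB : x ∈ B
    · simpa [hxA, hxB] using hMnn
    · have ha : ghat x ≤ 0 := hxA
      have hgx : 0 < g x := not_le.mp hxB
      have hxM : x ∈ M := by
        refine ⟨abs_pos.mpr hgx.ne', ?_⟩
        rw [abs_of_pos hgx]
        linarith
      have h10 : f1 x ≤ f0 x := by
        rw [← one_le_div p1]
        by_contra! hc
        rw [hg] at hgx
        linarith [Real.log_neg hr hc]
      have := sub_le_of_log_div_le p1 h10 (D := Δ) (by rw [← hg]; linarith)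
      simp [hxA, hxB, hxM]
      linarith
    · have ha : 0 < ghat x := not_le.mp hxA
      have hgx : g x ≤ 0 := hxB
      have h01 : f0 x ≤ f1 x := by
        rw [← div_le_one p1]
        by_contra! hc
        rw [hg] at hgx
        linarith [Real.log_pos hc]
      rcases hgx.lt_or_eq with hlt | heq
      · have hxM : x ∈ M := by
          refine ⟨abs_pos.mpr hlt.ne, ?_⟩
          rw [abs_of_neg hlt]
          linarith
        have hl : Real.log (f1 x / f0 x) = - g x := by
          rw [hg, ← Real.log_inv, inv_div]
        have := sub_le_of_log_div_le p0 h01 (D := Δ) (by rw [hl]; linarith)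
        simp [hxA, hxB, hxM]
        linarith
      · have h1 : f0 x / f1 x = 1 :=
          Real.eq_one_of_pos_of_log_eq_zero hr (by rw [← hg, heq])
        have h2 : f0 x = f1 x := (div_eq_one_iff_eq p1.ne').mp h1
        simpa [hxA, hxB, h2] using hMnn
    · simpa [hxA, hxB] using hMnn
  have key : (μ0 A).toReal + (μ1 Aᶜ).toReal ≤ ((μ0 B).toReal + (μ1 Bᶜ).toReal) +
      Δ / 2 * ((μ0 M).toReal + (μ1 M).toReal) := by
    have a0 := i0.indicator mA
    have a1 := i1.indicator mA.compl
    have b0 := i0.indicator mB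
    have b1 := i1.indicator mB.compl
    have m0 := i0.indicator mM
    have m1 := i1.indicator mM
    have hb : Integrable (fun x => B.indicator f0 x + Bᶜ.indicator f1 x) := b0.add b1
    have hm : Integrable (fun x => Δ / 2 * (M.indicator f0 x + M.indicator f1 x)) :=
      (m0.add m1).const_mul _
    rw [e0 A mA, e1 _ mA.compl, e0 B mB, e1 _ mB.compl, e0 M mM, e1 M mM,
      ← integral_add a0 a1, ← integral_add b0 b1, ← integral_add m0 m1,
      ← integral_const_mul, ← integral_add hb hm]
    exact integral_mono (a0.add a1) (hb.add hm) pointwise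
  have hm := mul_le_mul_of_nonneg_left (hmargin Δ hΔ) hΔ.le
  rw [hPXM] at hm
  rw [hR, hR, Real.rpow_add hΔ, Real.rpow_one]
  change 1 / 2 * (μ0 A).toReal + 1 / 2 * (μ1 Aᶜ).toReal -
    (1 / 2 * (μ0 B).toReal + 1 / 2 * (μ1 Bᶜ).toReal) ≤ _
  linarith
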